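/- Let p ≥ 2, α = p−1 and θ ≥ 0. There exist a constant c = c(α,θ) > 0 and μ₀ ∈ (0, μ_{α,θ}) such that for every μ with μ₀ ≤ μ < μ_{α,θ} one has TMSC(μ,α,θ) ≥ c / (1 − (μ/μ_{α,θ})^{p−1}). -/

import Mathlib

open MeasureTheory Real Filter ENNReal

/-- The fractional-dimension spherical volume constant `ω_θ = 2π^((θ+1)/2)/Γ((θ+1)/2)`. -/
noncomputable def omegaW (θ : ℝ) : ℝ := 2 * Real.pi ^ ((θ + 1) / 2) / Real.Gamma ((θ + 1) / 2)

/-- Weighted integral `∫₀^∞ f dλ_θ = ω_θ ∫₀^∞ f(r) r^θ dr` (for nonnegative integrands,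
valued in `ℝ≥0∞`). -/
noncomputable def wInt (θ : ℝ) (f : ℝ → ℝ) : ℝ≥0∞ :=
  ENNReal.ofReal (omegaW θ) *
    ∫⁻ r in Set.Ioi (0 : ℝ), ENNReal.ofReal (f r) * ENNReal.ofReal (r ^ θ)

/-- The weighted Lebesgue norm `‖u‖_{L^q_θ}` (valued in `ℝ≥0∞`). -/
noncomputable def wNorm (θ q : ℝ) (u : ℝ → ℝ) : ℝ≥0∞ :=
  (wInt θ fun r => |u r| ^ q) ^ (1 / q)

/-- Membership in the weighted Sobolev space `X = X^{1,p}_∞(α,θ)`: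
`u` is locally absolutely continuous on `(0,∞)` with a.e. derivative `u'`
(expressed through the fundamental theorem of calculus on compact subintervals),
`u(r) → 0` as `r → ∞`, `‖u‖_{L^p_θ} < ∞` and `‖u'‖_{L^p_α} < ∞`. -/
structure MemX (p α θ : ℝ) (u u' : ℝ → ℝ) : Prop where
  ftc_int : ∀ a b : ℝ, 0 < a → a ≤ b → IntervalIntegrable u' MeasureTheory.volume a b
  ftc : ∀ a b : ℝ, 0 < a → a ≤ b → u b - u a = ∫ t in a..b, u' t
  lim_zero : Filter.Tendsto u Filter.atTop (nhds 0)
  fin_u : wNorm θ p u < ⊤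
  fin_u' : wNorm α p u' < ⊤

/-- Full norm on `X`: `‖u‖ = (‖u‖_{L^p_θ}^p + ‖u'‖_{L^p_α}^p)^{1/p}`. -/
noncomputable def Xnorm (p α θ : ℝ) (u u' : ℝ → ℝ) : ℝ≥0∞ :=
  ((wNorm θ p u) ^ p + (wNorm α p u') ^ p) ^ (1 / p)

/-- The truncated exponential `φ_p(t) = Σ_{j ∈ ℕ, j ≥ p-1} t^j / j!`. -/
noncomputable def phiP (p t : ℝ) : ℝ :=
  ∑' j : ℕ, if p - 1 ≤ (j : ℝ) then t ^ j / (Nat.factorial j : ℝ) else 0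

/-- The critical constant `μ_{α,θ} = (θ+1) ω_α^{1/α}`. -/
noncomputable def muC (α θ : ℝ) : ℝ := (θ + 1) * (omegaW α) ^ (1 / α)

/-- The Trudinger–Moser functional `∫₀^∞ φ_p(μ |u|^{p/(p-1)}) dλ_θ`. -/
noncomputable def TMfunc (p θ μ : ℝ) (u : ℝ → ℝ) : ℝ≥0∞ :=
  wInt θ fun r => phiP p (μ * |u r| ^ (p / (p - 1)))

/-- The subcritical Trudinger–Moser supremum
`TMSC(μ,α,θ) = sup { ‖u‖_{L^p_θ}^{-p} ∫₀^∞ φ_p(μ|u|^{p/(p-1)}) dλ_θ : u ∈ X, u ≠ 0, ‖u'‖_{L^p_α} ≤ 1 }`. -/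
noncomputable def TMSC (p α θ μ : ℝ) : ℝ≥0∞ :=
  ⨆ (u : ℝ → ℝ) (u' : ℝ → ℝ) (_ : MemX p α θ u u') (_ : u ≠ 0)
    (_ : wNorm α p u' ≤ 1), (wNorm θ p u) ^ (-p) * TMfunc p θ μ u

/-- The critical Trudinger–Moser supremum
`TMC(σ,α,θ) = sup { ∫₀^∞ φ_p(σ|u|^{p/(p-1)}) dλ_θ : u ∈ X, ‖u‖ ≤ 1 }`. -/
noncomputable def TMC (p α θ σ : ℝ) : ℝ≥0∞ :=
  ⨆ (u : ℝ → ℝ) (u' : ℝ → ℝ) (_ : MemX p α θ u u') (_ : Xnorm p α θ u u' ≤ 1),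
    TMfunc p θ σ u

/-- `k₀ = min { j ∈ ℕ : j ≥ p - 1 }`. -/
noncomputable def k0 (p : ℝ) : ℕ := sInf {j : ℕ | p - 1 ≤ (j : ℝ)}

/-- `TMC(σ,α,θ)` is attained by some `u ∈ X` with `‖u‖ ≤ 1`. -/
def TMCAttained (p α θ σ : ℝ) : Prop :=
  ∃ u u' : ℝ → ℝ, MemX p α θ u u' ∧ Xnorm p α θ u u' ≤ 1 ∧
    TMC p α θ σ = TMfunc p θ σ u

/-- `σ_* = inf { σ ∈ (0, μ_{α,θ}) : TMC(σ,α,θ) is attained }`. -/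
noncomputable def sigmaStar (p α θ : ℝ) : ℝ :=
  sInf {σ : ℝ | σ ∈ Set.Ioo 0 (muC α θ) ∧ TMCAttained p α θ σ}

lemma omegaW_pos {θ : ℝ} (hθ : 0 ≤ θ) : 0 < omegaW θ := by
  have := Real.Gamma_pos_of_pos (show 0 < (θ + 1) / 2 by positivity)
  unfold omegaW
  positivity

lemma wNorm_rpow_neg {p : ℝ} (hp : p ≠ 0) (θ : ℝ) (u : ℝ → ℝ) :
    wNorm θ p u ^ (-p) = (wInt θ fun r => |u r| ^ p)⁻¹ := by
  rw [wNorm, ← ENNReal.rpow_mul, show 1 / p * -p = -1 by field_simp, ENNReal.rpow_neg_one]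

/-- The truncated exponential dominates a multiple of the exponential on `[1, ∞)`. -/
lemma exists_mul_exp_le_phiP (p : ℝ) :
    ∃ c : ℝ, 0 < c ∧ ∀ s : ℝ, 1 ≤ s → c * Real.exp s ≤ phiP p s := by
  set k : ℕ := ⌈p - 1⌉₊
  have hkf : (0 : ℝ) < k.factorial := by positivity
  refine ⟨1 / (Real.exp 1 * k.factorial + 1), by positivity, fun s hs => ?_⟩
  have hs0 : 0 ≤ s := by linarith
  have hsum : Summable fun j : ℕ => s ^ j / (j.factorial : ℝ) :=
    Real.summable_pow_div_factorial s
  have hnn : ∀ j : ℕ, 0 ≤ s ^ j / (j.factorial : ℝ) := fun j => by positivity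
  have hphi_sum : Summable fun j : ℕ =>
      if p - 1 ≤ (j : ℝ) then s ^ j / (j.factorial : ℝ) else 0 :=
    hsum.of_nonneg_of_le (fun j => by split_ifs; exacts [hnn j, le_rfl])
      (fun j => by split_ifs; exacts [le_rfl, hnn j])
  have hphi_term : s ^ k / (k.factorial : ℝ) ≤ phiP p s := by
    have := hphi_sum.le_tsum k (fun j _ => by split_ifs; exacts [hnn j, le_rfl])
    rwa [if_pos (Nat.le_ceil _)] at this
  have hexp1 : ∑' j : ℕ, (1 : ℝ) / (j.factorial : ℝ) = Real.exp 1 := by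
    rw [Real.exp_eq_exp_ℝ, NormedSpace.exp_eq_tsum_div]; simp
  have h1sum : Summable fun j : ℕ => (1 : ℝ) / (j.factorial : ℝ) := by
    simpa using Real.summable_pow_div_factorial 1
  have hexp : Real.exp s ≤ s ^ k * Real.exp 1 + phiP p s := by
    have hexps : Real.exp s = ∑' j : ℕ, s ^ j / (j.factorial : ℝ) := by
      rw [Real.exp_eq_exp_ℝ, NormedSpace.exp_eq_tsum_div]
    rw [hexps, ← hexp1, ← tsum_mul_left, phiP, ← (h1sum.mul_left _).tsum_add hphi_sum]
    refine hsum.tsum_le_tsum (fun j => ?_) ((h1sum.mul_left _).add hphi_sum)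
    split_ifs with h
    · have : 0 ≤ s ^ k * (1 / (j.factorial : ℝ)) := by positivity
      linarith
    · have hjk : j ≤ k := by
        have h' : (j : ℝ) < k := lt_of_lt_of_le (not_le.mp h) (Nat.le_ceil _)
        exact_mod_cast h'.le
      rw [add_zero, mul_one_div]
      gcongr
  have hpow : s ^ k ≤ k.factorial * phiP p s := by
    rw [div_le_iff₀ hkf] at hphi_term; linarith
  rw [one_div, inv_mul_le_iff₀ (by positivity)]
  nlinarith [mul_le_mul_of_nonneg_right hpow (Real.exp_pos 1).le]

/-- The Moser function: a logarithm truncated at height `L`, supported in the unit ball. -/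
noncomputable def moser (A L r : ℝ) : ℝ := A * min L (max 0 (-Real.log r))

/-- The almost everywhere derivative of `moser A L`. -/
noncomputable def moserDeriv (A L r : ℝ) : ℝ :=
  (Set.Ioc (Real.exp (-L)) 1).indicator (fun r => -(A * r⁻¹)) r

lemma moser_of_le {A L r : ℝ} (hr : 0 < r) (h : r ≤ Real.exp (-L)) :
    moser A L r = A * L := by
  have : Real.log r ≤ -L := (Real.log_le_iff_le_exp hr).2 h
  rw [moser, min_eq_left (le_max_of_le_right (by linarith))]

lemma moser_of_mem {A L r : ℝ} (h1 : Real.exp (-L) ≤ r) (h2 : r ≤ 1) :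
    moser A L r = A * (-Real.log r) := by
  have hr : 0 < r := (Real.exp_pos _).trans_le h1
  have h3 : -L ≤ Real.log r := (Real.le_log_iff_exp_le hr).2 h1
  have h4 := Real.log_nonpos hr.le h2
  rw [moser, max_eq_right (by linarith), min_eq_right (by linarith)]

lemma moser_of_one_le {A L r : ℝ} (hL : 0 ≤ L) (h : 1 ≤ r) : moser A L r = 0 := by
  have := Real.log_nonneg h
  rw [moser, max_eq_left (by linarith), min_eq_right hL, mul_zero]

lemma continuousOn_moser (A L : ℝ) : ContinuousOn (moser A L) (Set.Ioi 0) := by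
  have : ContinuousOn Real.log (Set.Ioi 0) :=
    Real.continuousOn_log.mono fun x hx => (Set.mem_Ioi.1 hx).ne'
  unfold moser
  fun_prop

lemma hasDerivAt_moser {A L r : ℝ} (hL : 0 ≤ L) (hr : 0 < r) (h1 : r ≠ Real.exp (-L))
    (h2 : r ≠ 1) : HasDerivAt (moser A L) (moserDeriv A L r) r := by
  rcases lt_or_gt_of_ne h1 with h | h
  · rw [moserDeriv, Set.indicator_of_notMem (by simp [h.le])]
    refine (hasDerivAt_const r (A * L)).congr_of_eventuallyEq ?_
    filter_upwards [Ioo_mem_nhds hr h] with x hx using moser_of_le hx.1 hx.2.le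
  rcases lt_or_gt_of_ne h2 with h' | h'
  · rw [moserDeriv, Set.indicator_of_mem (Set.mem_Ioc.2 ⟨h, h'.le⟩)]
    have := ((Real.hasDerivAt_log hr.ne').neg.const_mul A)
    rw [mul_neg] at this
    refine this.congr_of_eventuallyEq ?_
    filter_upwards [Ioo_mem_nhds h h'] with x hx using moser_of_mem hx.1.le hx.2.le
  · rw [moserDeriv, Set.indicator_of_notMem (by simp [h'])]
    refine (hasDerivAt_const r (0 : ℝ)).congr_of_eventuallyEq ?_
    filter_upwards [Ioi_mem_nhds h'] with x hx using moser_of_one_le hL (le_of_lt hx)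

lemma intervalIntegrable_moserDeriv (A L : ℝ) {a b : ℝ} (ha : 0 < a) (hab : a ≤ b) :
    IntervalIntegrable (moserDeriv A L) volume a b := by
  rw [intervalIntegrable_iff_integrableOn_Ioc_of_le hab]
  refine IntegrableOn.indicator ?_ measurableSet_Ioc
  refine (ContinuousOn.integrableOn_Icc ?_).mono_set Set.Ioc_subset_Icc_self
  exact ((continuousOn_inv₀.mono fun x hx => (ha.trans_le hx.1).ne').const_mul _ |>.neg :
    ContinuousOn (fun r : ℝ => -(A * r⁻¹)) (Set.Icc a b))

lemma moser_sub_moser (A : ℝ) {L a b : ℝ} (hL : 0 ≤ L) (ha : 0 < a) (hab : a ≤ b) :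
    moser A L b - moser A L a = ∫ t in a..b, moserDeriv A L t := by
  refine (integral_eq_of_hasDerivAt_off_countable_of_le _ _ hab
    (s := {Real.exp (-L), 1}) (by simp) ?_ ?_
    (intervalIntegrable_moserDeriv A L ha hab)).symm
  · exact (continuousOn_moser A L).mono fun x hx => ha.trans_le hx.1
  · intro x hx
    have := hx.2
    simp only [Set.mem_insert_iff, Set.mem_singleton_iff, not_or] at this
    exact hasDerivAt_moser hL (ha.trans hx.1.1) this.1 this.2

lemma wInt_moserDeriv_le {p A L : ℝ} (hp : 1 ≤ p) (hA : 0 ≤ A) (hL : 0 ≤ L) :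
    wInt (p - 1) (fun r => |moserDeriv A L r| ^ p) ≤
      ENNReal.ofReal (omegaW (p - 1) * (A ^ p * L)) := by
  have hω := omegaW_pos (show 0 ≤ p - 1 by linarith)
  have he : Real.exp (-L) ≤ 1 := Real.exp_le_one_iff.2 (by linarith)
  have hint : IntegrableOn (fun r : ℝ => A ^ p * r⁻¹) (Set.Ioc (Real.exp (-L)) 1) := by
    refine (ContinuousOn.integrableOn_Icc ?_).mono_set Set.Ioc_subset_Icc_self
    exact (continuousOn_inv₀.mono fun x hx => ((Real.exp_pos _).trans_le hx.1).ne').const_mul _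
  have hval : ∫ r in Set.Ioc (Real.exp (-L)) 1, A ^ p * r⁻¹ = A ^ p * L := by
    rw [← intervalIntegral.integral_of_le he, intervalIntegral.integral_const_mul,
      integral_inv_of_pos (Real.exp_pos _) one_pos]
    simp
  rw [wInt, ENNReal.ofReal_mul hω.le]
  gcongr
  rw [← hval, ofReal_integral_eq_lintegral_ofReal hint]
  · rw [← lintegral_indicator measurableSet_Ioi, ← lintegral_indicator measurableSet_Ioc]
    refine lintegral_mono fun r => ?_
    by_cases hr : r ∈ Set.Ioc (Real.exp (-L)) 1
    · have hr0 : 0 < r := (Real.exp_pos _).trans hr.1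
      rw [Set.indicator_of_mem hr, Set.indicator_of_mem (Set.mem_Ioi.2 hr0), moserDeriv,
        Set.indicator_of_mem hr, ← ENNReal.ofReal_mul (by positivity), abs_neg,
        abs_of_nonneg (by positivity), Real.mul_rpow hA (by positivity), mul_assoc,
        Real.inv_rpow hr0.le, ← Real.rpow_neg hr0.le, ← Real.rpow_add hr0,
        show -p + (p - 1) = -1 by ring, Real.rpow_neg_one]
    · rw [Set.indicator_of_notMem hr]
      refine (Set.indicator_apply_eq_zero.2 fun _ => ?_).le
      rw [moserDeriv, Set.indicator_of_notMem hr, abs_zero, Real.zero_rpow (by linarith),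
        ENNReal.ofReal_zero, zero_mul]
  · filter_upwards [ae_restrict_mem measurableSet_Ioc] with r hr
    have hr0 : 0 < r := (Real.exp_pos _).trans hr.1
    simp only [Pi.zero_apply]; positivity

lemma neg_log_rpow_le {p r : ℝ} (hp : 0 < p) (hr : 0 < r) (hr1 : r ≤ 1) :
    (-Real.log r) ^ p ≤ (2 * p) ^ p * r ^ (-(1 / 2) : ℝ) := by
  have h := Real.abs_log_mul_self_rpow_lt r (1 / (2 * p)) hr hr1 (by positivity)
  have hl := Real.log_nonpos hr.le hr1
  rw [abs_mul, abs_of_nonpos hl, abs_of_pos (Real.rpow_pos_of_pos hr _), one_div_one_div] at h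
  have h2 : -Real.log r ≤ 2 * p * r ^ (-(1 / (2 * p))) := by
    rw [Real.rpow_neg hr.le, ← div_eq_mul_inv, le_div_iff₀ (Real.rpow_pos_of_pos hr _)]
    exact h.le
  calc (-Real.log r) ^ p ≤ (2 * p * r ^ (-(1 / (2 * p)))) ^ p :=
        Real.rpow_le_rpow (by linarith) h2 hp.le
    _ = _ := by
        rw [Real.mul_rpow (by positivity) (by positivity), ← Real.rpow_mul hr.le]
        congr 2; field_simp

lemma wInt_moser_le {p θ A L : ℝ} (hp : 1 ≤ p) (hθ : 0 ≤ θ) (hA : 0 ≤ A) (hL : 0 ≤ L) :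
    wInt θ (fun r => |moser A L r| ^ p) ≤
      ENNReal.ofReal (omegaW θ * (A ^ p * (2 * p) ^ p * 2)) := by
  have hω := omegaW_pos hθ
  have hii : IntervalIntegrable (fun r : ℝ => A ^ p * (2 * p) ^ p * r ^ (-(1 / 2) : ℝ))
      volume 0 1 := (intervalIntegral.intervalIntegrable_rpow' (by norm_num)).const_mul _
  have hint := (intervalIntegrable_iff_integrableOn_Ioc_of_le zero_le_one).1 hii
  have hval : ∫ r in Set.Ioc (0 : ℝ) 1, A ^ p * (2 * p) ^ p * r ^ (-(1 / 2) : ℝ) =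
      A ^ p * (2 * p) ^ p * 2 := by
    rw [← intervalIntegral.integral_of_le zero_le_one, intervalIntegral.integral_const_mul,
      integral_rpow (Or.inl (by norm_num))]
    norm_num
  rw [wInt, ENNReal.ofReal_mul hω.le]
  gcongr
  rw [← hval, ofReal_integral_eq_lintegral_ofReal hint]
  · rw [← lintegral_indicator measurableSet_Ioi, ← lintegral_indicator measurableSet_Ioc]
    refine lintegral_mono fun r => ?_
    by_cases hr : r ∈ Set.Ioc (0 : ℝ) 1
    · have hr0 : 0 < r := hr.1
      rw [Set.indicator_of_mem hr, Set.indicator_of_mem (Set.mem_Ioi.2 hr0),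
        ← ENNReal.ofReal_mul (by positivity)]
      apply ENNReal.ofReal_le_ofReal
      have hlog := Real.log_nonpos hr0.le hr.2
      have hu : |moser A L r| ≤ A * (-Real.log r) := by
        rw [moser, max_eq_right (by linarith), abs_of_nonneg]
        · gcongr; exact min_le_right _ _
        · exact mul_nonneg hA (le_min hL (by linarith))
      have hup : |moser A L r| ^ p ≤ A ^ p * (-Real.log r) ^ p := by
        rw [← Real.mul_rpow hA (by linarith)]
        exact Real.rpow_le_rpow (abs_nonneg _) hu (by linarith)
      calc |moser A L r| ^ p * r ^ θ ≤ |moser A L r| ^ p * 1 := by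
            gcongr; exact Real.rpow_le_one hr0.le hr.2 hθ
        _ ≤ A ^ p * (-Real.log r) ^ p := by rwa [mul_one]
        _ ≤ A ^ p * ((2 * p) ^ p * r ^ (-(1 / 2) : ℝ)) := by
            gcongr; exact neg_log_rpow_le (by linarith) hr0 hr.2
        _ = _ := by ring
    · rw [Set.indicator_of_notMem hr]
      by_cases h0 : 0 < r
      · have h1 : 1 ≤ r := by
          by_contra h; exact hr ⟨h0, (not_le.1 h).le⟩
        simp [moser_of_one_le hL h1, Real.zero_rpow (show p ≠ 0 by linarith), Set.indicator]
      · simp [Set.indicator, h0]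
  · filter_upwards [ae_restrict_mem measurableSet_Ioc] with r hr
    have hr0 : 0 < r := hr.1
    simp only [Pi.zero_apply]; positivity

lemma memX_moser {p θ A L : ℝ} (hp : 1 ≤ p) (hθ : 0 ≤ θ) (hA : 0 ≤ A) (hL : 0 ≤ L) :
    MemX p (p - 1) θ (moser A L) (moserDeriv A L) where
  ftc_int _ _ := intervalIntegrable_moserDeriv A L
  ftc _ _ := moser_sub_moser A hL
  lim_zero := tendsto_const_nhds.congr' <| by
    filter_upwards [eventually_ge_atTop 1] with r hr using (moser_of_one_le hL hr).symm
  fin_u := ENNReal.rpow_lt_top_of_nonneg (by positivity)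
    ((wInt_moser_le hp hθ hA hL).trans_lt ENNReal.ofReal_lt_top).ne
  fin_u' := ENNReal.rpow_lt_top_of_nonneg (by positivity)
    ((wInt_moserDeriv_le hp hA hL).trans_lt ENNReal.ofReal_lt_top).ne

lemma le_TMfunc_moser {p θ μ A L : ℝ} (hθ : 0 ≤ θ) (hA : 0 ≤ A) (hL : 0 ≤ L)
    (hφ : 0 ≤ phiP p (μ * (A * L) ^ (p / (p - 1)))) :
    ENNReal.ofReal (omegaW θ * (phiP p (μ * (A * L) ^ (p / (p - 1))) *
      (Real.exp (-((θ + 1) * L)) / (θ + 1)))) ≤ TMfunc p θ μ (moser A L) := by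
  have hω := omegaW_pos hθ
  have he := Real.exp_pos (-L)
  set φ := phiP p (μ * (A * L) ^ (p / (p - 1)))
  have hii : IntervalIntegrable (fun r : ℝ => φ * r ^ θ) volume 0 (Real.exp (-L)) :=
    (intervalIntegral.intervalIntegrable_rpow' (by linarith)).const_mul _
  have hint := (intervalIntegrable_iff_integrableOn_Ioc_of_le he.le).1 hii
  have hval : ∫ r in Set.Ioc (0 : ℝ) (Real.exp (-L)), φ * r ^ θ =
      φ * (Real.exp (-((θ + 1) * L)) / (θ + 1)) := by
    rw [← intervalIntegral.integral_of_le he.le, intervalIntegral.integral_const_mul,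
      integral_rpow (Or.inl (by linarith)), Real.zero_rpow (by linarith), sub_zero,
      ← Real.exp_mul]
    congr 3; ring
  rw [TMfunc, wInt, ENNReal.ofReal_mul hω.le]
  gcongr
  rw [← hval, ofReal_integral_eq_lintegral_ofReal hint]
  · refine le_trans (setLIntegral_mono' measurableSet_Ioc fun r hr => ?_)
      (lintegral_mono_set Set.Ioc_subset_Ioi_self)
    rw [moser_of_le hr.1 hr.2, abs_of_nonneg (by positivity), ENNReal.ofReal_mul hφ]
  · filter_upwards [ae_restrict_mem measurableSet_Ioc] with r hr
    have hr0 : 0 < r := hr.1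
    simp only [Pi.zero_apply]; positivity

/-- The lower bound for `TMSC` obtained by testing with the normalised Moser function. -/
lemma le_TMSC_of_moser {p θ μ c L : ℝ} (hp : 2 ≤ p) (hθ : 0 ≤ θ) (hc : 0 ≤ c) (hL : 0 < L)
    (hφ : c * Real.exp (μ / muC (p - 1) θ * ((θ + 1) * L)) ≤
      phiP p (μ / muC (p - 1) θ * ((θ + 1) * L))) :
    ENNReal.ofReal (c * omegaW (p - 1) / (2 * (2 * p) ^ p * (θ + 1)) * L *
      Real.exp (-(1 - μ / muC (p - 1) θ) * ((θ + 1) * L))) ≤ TMSC p (p - 1) θ μ := by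
  have hωθ := omegaW_pos hθ
  have hω := omegaW_pos (show 0 ≤ p - 1 by linarith)
  have hp1 : 0 < p - 1 := by linarith
  set ω := omegaW (p - 1) with hωdef
  have hm : muC (p - 1) θ = (θ + 1) * ω ^ (1 / (p - 1)) := rfl
  set A : ℝ := (ω * L) ^ (-(1 / p)) with hAdef
  have hA : 0 < A := by positivity
  have hAp : A ^ p = (ω * L)⁻¹ := by
    rw [hAdef, ← Real.rpow_mul (by positivity), show -(1 / p) * p = -1 by field_simp,
      Real.rpow_neg_one]
  have hAL : μ * (A * L) ^ (p / (p - 1)) = μ / muC (p - 1) θ * ((θ + 1) * L) := by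
    have h1 : A ^ (p / (p - 1)) = (ω ^ (1 / (p - 1)))⁻¹ * (L ^ (1 / (p - 1)))⁻¹ := by
      rw [div_eq_mul_one_div, Real.rpow_mul hA.le, hAp, Real.inv_rpow (by positivity),
        Real.mul_rpow hω.le hL.le, mul_inv]
    have h2 : L ^ (p / (p - 1)) = L ^ (1 / (p - 1)) * L := by
      rw [show p / (p - 1) = 1 / (p - 1) + 1 by field_simp; ring, Real.rpow_add hL,
        Real.rpow_one]
    have h3 : 0 < ω ^ (1 / (p - 1)) := by positivity
    have h4 : 0 < L ^ (1 / (p - 1)) := by positivity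
    rw [Real.mul_rpow hA.le hL.le, h1, h2, hm]
    field_simp
  rw [← hAL] at hφ
  have hφ0 : 0 ≤ phiP p (μ * (A * L) ^ (p / (p - 1))) := le_trans (by positivity) hφ
  have hne : moser A L ≠ 0 := fun h => by
    have h1 := congrFun h (Real.exp (-L))
    rw [moser_of_le (Real.exp_pos _) le_rfl] at h1
    exact (mul_pos hA hL).ne' h1
  have hgrad : wNorm (p - 1) p (moserDeriv A L) ≤ 1 := by
    have := wInt_moserDeriv_le (show 1 ≤ p by linarith) hA.le hL.le
    rw [hAp, ← hωdef, show ω * ((ω * L)⁻¹ * L) = 1 by field_simp, ENNReal.ofReal_one] at this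
    exact ENNReal.rpow_le_one this (by positivity)
  refine le_trans ?_ (le_iSup₂_of_le (moser A L) (moserDeriv A L)
    (le_iSup₂_of_le (memX_moser (by linarith) hθ hA.le hL.le) hne
      (le_iSup_of_le hgrad le_rfl)))
  rw [wNorm_rpow_neg (by linarith)]
  have hN := ENNReal.inv_le_inv.2 (wInt_moser_le (show 1 ≤ p by linarith) hθ hA.le hL.le)
  rw [← ENNReal.ofReal_inv_of_pos (by positivity)] at hN
  refine le_trans ?_ (mul_le_mul' hN (le_TMfunc_moser hθ hA.le hL.le hφ0))
  rw [← ENNReal.ofReal_mul (by positivity)]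
  apply ENNReal.ofReal_le_ofReal
  calc _ = (omegaW θ * (A ^ p * (2 * p) ^ p * 2))⁻¹ * (omegaW θ *
        (c * Real.exp (μ * (A * L) ^ (p / (p - 1))) *
          (Real.exp (-((θ + 1) * L)) / (θ + 1)))) := by
        rw [hAp, hAL, show -(1 - μ / muC (p - 1) θ) * ((θ + 1) * L) =
          μ / muC (p - 1) θ * ((θ + 1) * L) + -((θ + 1) * L) by ring, Real.exp_add]
        field_simp
    _ ≤ _ := by gcongr

theorem stmt_1 (p α θ : ℝ) (hp : 2 ≤ p) (hα : α = p - 1) (hθ : 0 ≤ θ) :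
    ∃ c : ℝ, 0 < c ∧ ∃ μ₀ : ℝ, μ₀ ∈ Set.Ioo 0 (muC α θ) ∧
      ∀ μ : ℝ, μ₀ ≤ μ → μ < muC α θ →
        ENNReal.ofReal (c / (1 - (μ / muC α θ) ^ (p - 1))) ≤ TMSC p α θ μ := by
  subst hα
  obtain ⟨c, hc, hφ⟩ := exists_mul_exp_le_phiP p
  have hω := omegaW_pos (show 0 ≤ p - 1 by linarith)
  have hm : 0 < muC (p - 1) θ := by unfold muC; positivity
  refine ⟨c * omegaW (p - 1) / (2 * (2 * p) ^ p * (θ + 1)) * Real.exp (-(θ + 1)),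
    by positivity, muC (p - 1) θ / 2, ⟨by linarith, by linarith⟩, fun μ hμ₀ hμ => ?_⟩
  set τ := μ / muC (p - 1) θ with hτ
  have hτ1 : τ < 1 := (div_lt_one hm).2 hμ
  have hτ2 : 1 / 2 ≤ τ := by rw [hτ, le_div_iff₀ hm]; linarith
  have hL : 0 < 1 / (1 - τ) := one_div_pos.2 (by linarith)
  have hL2 : 2 ≤ 1 / (1 - τ) := by rw [le_div_iff₀ (by linarith)]; linarith
  have hs : 1 ≤ τ * ((θ + 1) * (1 / (1 - τ))) := by
    have h : 2 ≤ (θ + 1) * (1 / (1 - τ)) := by nlinarith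
    nlinarith
  refine le_trans (ENNReal.ofReal_le_ofReal ?_) (le_TMSC_of_moser hp hθ hc.le hL (hφ _ hs))
  have hpow : τ ^ (p - 1) ≤ τ :=
    Real.rpow_le_self_of_le_one (by linarith) hτ1.le (by linarith)
  have h1 : 0 < 1 - τ := by linarith
  have hexp : -(1 - τ) * ((θ + 1) * (1 / (1 - τ))) = -(θ + 1) := by field_simp
  rw [hexp, mul_right_comm _ (1 / (1 - τ)), mul_one_div]
  have h2 : 1 - τ ≤ 1 - τ ^ (p - 1) := by linarith
  exact div_le_div_of_nonneg_left (by positivity) h1 h2
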